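/- Let Λ be any quantum channel on n qubits, let 1 ≤ k ≤ n, let ℰ(ζ) = Λ(ζ ⊗ (|0⟩⟨0|)^{⊗(n−k)}) be the associated encoding channel from k-qubit states to n-qubit states, and let ρ = (Id ⊗ ℰ)(|Φ⟩⟨Φ|) for the maximally entangled state Φ_k, with ρ_B its partial trace over the reference factor. Let Λ̃ denote Λ applied to each of the two copies of the n-qubit system (i.e., Λ^{⊗2}, with tensor factors reordered so that the doubled space is organized qubit-wise as (ℂ²⊗ℂ²)^{⊗n}), and let 𝕊 = 𝒮^{⊗n} be the full swap of the two copies. Then: (1) Tr(ρ_B²) = Tr[ 𝕊 · Λ̃( (I/4)^{⊗k} ⊗ (|0⟩⟨0| ⊗ |0⟩⟨0|)^{⊗(n−k)} ) ]; and (2) Tr(ρ²) = 2^{−k} Tr[ 𝕊 · Λ̃( (𝒮/2)^{⊗k} ⊗ (|0⟩⟨0| ⊗ |0⟩⟨0|)^{⊗(n−k)} ) ]. -/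

import Mathlib

open Matrix

noncomputable section

/-- Partial trace over the first (reference) tensor factor. -/
def ptraceFirst {R B : Type*} [Fintype R] (M : Matrix (R × B) (R × B) ℂ) : Matrix B B ℂ :=
  Matrix.of fun b b' => ∑ r, M (r, b) (r, b')

/-- Density matrix of the maximally entangled state `|Φ⟩ = (card A)^{-1/2} ∑ᵢ |i⟩⊗|i⟩`. -/
def maxEnt (A : Type*) [Fintype A] [DecidableEq A] : Matrix (A × A) (A × A) ℂ :=
  Matrix.of fun x y => if x.1 = x.2 ∧ y.1 = y.2 then ((Fintype.card A : ℂ))⁻¹ else 0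

/-- The map `Id ⊗ ℰ` acting on operators on `R ⊗ A`, defined entrywise. -/
def idTensor {R A B : Type*} (E : Matrix A A ℂ → Matrix B B ℂ)
    (M : Matrix (R × A) (R × A) ℂ) : Matrix (R × B) (R × B) ℂ :=
  Matrix.of fun x y => E (Matrix.of fun a a' => M (x.1, a) (y.1, a')) x.2 y.2

/-- Von Neumann entropy in bits, `S(ρ) = -Tr[ρ log₂ ρ]`, via the eigenvalues of `ρ`
(with the convention `0 log 0 = 0`). -/
def vN {ι : Type*} [Fintype ι] [DecidableEq ι] (ρ : Matrix ι ι ℂ) : ℝ :=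
  if h : ρ.IsHermitian then -∑ i, (h.eigenvalues i) * Real.logb 2 (h.eigenvalues i) else 0

/-- Coherent information of a channel on the maximally mixed input:
`I_c = S(ρ_B) − S(ρ_RB)` where `ρ_RB = (Id ⊗ ℰ)(|Φ⟩⟨Φ|)`. -/
def cohInfo {A B : Type*} [Fintype A] [DecidableEq A] [Fintype B] [DecidableEq B]
    (E : Matrix A A ℂ → Matrix B B ℂ) : ℝ :=
  vN (ptraceFirst (idTensor (R := A) E (maxEnt A))) - vN (idTensor (R := A) E (maxEnt A))

/-- Hilbert-space index for `n` qubits. -/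
abbrev QSpace (n : ℕ) := Fin n → Fin 2

/-- The Pauli matrices `I, X, Y, Z` indexed by `Fin 4`. -/
def pauli (s : Fin 4) : Matrix (Fin 2) (Fin 2) ℂ :=
  if s = 0 then 1
  else if s = 1 then !![0, 1; 1, 0]
  else if s = 2 then !![0, -Complex.I; Complex.I, 0]
  else !![1, 0; 0, -1]

/-- Probability weights of the depolarizing channel of strength `p`:
`1 − p` for `I` and `p/3` for each of `X, Y, Z`. -/
def pauliWeight (p : ℝ) (s : Fin 4) : ℝ := if s = 0 then 1 - p else p / 3

/-- A tensor product of Pauli matrices over the `n` qubits. -/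
def pauliString {n : ℕ} (s : Fin n → Fin 4) : Matrix (QSpace n) (QSpace n) ℂ :=
  Matrix.of fun x y => ∏ i, pauli (s i) (x i) (y i)

/-- `D_p^{⊗n}`: one layer of single-qubit depolarizing noise of strength `p`
acting independently on each of the `n` qubits. -/
def depolLayer {n : ℕ} (p : ℝ) (ρ : Matrix (QSpace n) (QSpace n) ℂ) :
    Matrix (QSpace n) (QSpace n) ℂ :=
  ∑ s : Fin n → Fin 4, ((∏ i, pauliWeight p (s i) : ℝ) : ℂ) • (pauliString s * ρ * (pauliString s)ᴴ)

/-- The depth-`d` noisy circuit `C̃ = D_p^{⊗n} ∘ 𝒰_d ∘ ⋯ ∘ D_p^{⊗n} ∘ 𝒰_1`,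
where `𝒰_i(ρ) = U_i ρ U_i†`. -/
def noisyCircuit {n : ℕ} (p : ℝ) {d : ℕ} (U : Fin d → Matrix (QSpace n) (QSpace n) ℂ)
    (ρ : Matrix (QSpace n) (QSpace n) ℂ) : Matrix (QSpace n) (QSpace n) ℂ :=
  (List.ofFn U).foldl (fun σ V => depolLayer p (V * σ * Vᴴ)) ρ

/-- The encoding channel `ℰ(ζ) = C(ζ ⊗ (|0⟩⟨0|)^{⊗(n−k)})`, where the first `k` qubits
carry the logical state `ζ` and the remaining `n − k` qubits are ancillas in `|0⟩`. -/
def encode {n k : ℕ} (hk : k ≤ n)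
    (C : Matrix (QSpace n) (QSpace n) ℂ → Matrix (QSpace n) (QSpace n) ℂ)
    (ζ : Matrix (QSpace k) (QSpace k) ℂ) : Matrix (QSpace n) (QSpace n) ℂ :=
  C (Matrix.of fun x y =>
    (∏ i : Fin n, if (i : ℕ) < k then (1 : ℂ) else (if x i = 0 ∧ y i = 0 then 1 else 0)) *
      ζ (fun j => x (Fin.castLE hk j)) (fun j => y (Fin.castLE hk j)))

/-- The swap operator `𝒮` on `ℂ² ⊗ ℂ²`, `𝒮(u ⊗ v) = v ⊗ u`. -/
def swapOp : Matrix (Fin 2 × Fin 2) (Fin 2 × Fin 2) ℂ :=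
  Matrix.of fun p q => if p.1 = q.2 ∧ p.2 = q.1 then 1 else 0

/-- The single-site operators `O_0 = I/4` and `O_1 = 𝒮/2` on a doubled qubit. -/
noncomputable def O01 (b : Fin 2) : Matrix (Fin 2 × Fin 2) (Fin 2 × Fin 2) ℂ :=
  if b = 0 then (4 : ℂ)⁻¹ • 1 else (2 : ℂ)⁻¹ • swapOp

/-- Tensor product over the sites of single-site operators on the doubled space. -/
def tensorSites {ι : Type*} [Fintype ι]
    (f : ι → Matrix (Fin 2 × Fin 2) (Fin 2 × Fin 2) ℂ) :
    Matrix (ι → Fin 2 × Fin 2) (ι → Fin 2 × Fin 2) ℂ :=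
  Matrix.of fun x y => ∏ i, f i (x i) (y i)

/-- The symmetrized basis operator
`|S⟩ = C(n,S)⁻¹ ∑_{|σ| = S} ⊗ᵢ O_{σᵢ}` on the doubled space. -/
noncomputable def basisS {ι : Type*} [Fintype ι] [DecidableEq ι] (S : ℕ) :
    Matrix (ι → Fin 2 × Fin 2) (ι → Fin 2 × Fin 2) ℂ :=
  (((Fintype.card ι).choose S : ℂ))⁻¹ •
    ∑ σ ∈ Finset.univ.filter
        (fun σ : ι → Fin 2 => (Finset.univ.filter fun i => σ i = 1).card = S),
      tensorSites fun i => O01 (σ i)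

/-- `𝕊 = 𝒮^{⊗n}`: the two-copy swap applied to every site. -/
def fullSwapSites (ι : Type*) [Fintype ι] :
    Matrix (ι → Fin 2 × Fin 2) (ι → Fin 2 × Fin 2) ℂ :=
  tensorSites fun _ => swapOp

open Kronecker

/-- The projector `|0⟩⟨0| ⊗ |0⟩⟨0|` on a doubled qubit. -/
def ket00 : Matrix (Fin 2 × Fin 2) (Fin 2 × Fin 2) ℂ :=
  (!![1, 0; 0, 0] : Matrix (Fin 2) (Fin 2) ℂ) ⊗ₖ (!![1, 0; 0, 0] : Matrix (Fin 2) (Fin 2) ℂ)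

/-- The doubled Kraus operator `K_j ⊗ K_l` on the qubit-wise reordered two-copy space
`(ℂ²⊗ℂ²)^{⊗n}`. -/
def doubledKraus {n : ℕ} (Kj Kl : Matrix (QSpace n) (QSpace n) ℂ) :
    Matrix (Fin n → Fin 2 × Fin 2) (Fin n → Fin 2 × Fin 2) ℂ :=
  Matrix.of fun x y =>
    Kj (fun i => (x i).1) (fun i => (y i).1) * Kl (fun i => (x i).2) (fun i => (y i).2)

/-- `Λ̃ = Λ ⊗ Λ` (two independent copies of the `n`-qubit channel `Λ` with Kraus operators
`K`), acting on the qubit-wise reordered doubled space. -/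
def doubledChannel {n s : ℕ} (K : Fin s → Matrix (QSpace n) (QSpace n) ℂ)
    (O : Matrix (Fin n → Fin 2 × Fin 2) (Fin n → Fin 2 × Fin 2) ℂ) :
    Matrix (Fin n → Fin 2 × Fin 2) (Fin n → Fin 2 × Fin 2) ℂ :=
  ∑ j : Fin s, ∑ l : Fin s, doubledKraus (K j) (K l) * O * (doubledKraus (K j) (K l))ᴴ

theorem doubledKraus_eq_submatrix_kronecker {n : ℕ} (A B : Matrix (QSpace n) (QSpace n) ℂ) :
    doubledKraus A B =
      (A ⊗ₖ B).submatrix (Equiv.arrowProdEquivProdArrow (Fin n) (fun _ => Fin 2) fun _ => Fin 2)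
        (Equiv.arrowProdEquivProdArrow (Fin n) (fun _ => Fin 2) fun _ => Fin 2) :=
  rfl

theorem doubledKraus_mul {n : ℕ} (A B C D : Matrix (QSpace n) (QSpace n) ℂ) :
    doubledKraus A B * doubledKraus C D = doubledKraus (A * C) (B * D) := by
  simp only [doubledKraus_eq_submatrix_kronecker, submatrix_mul_equiv, mul_kronecker_mul]

theorem doubledKraus_conjTranspose {n : ℕ} (A B : Matrix (QSpace n) (QSpace n) ℂ) :
    (doubledKraus A B)ᴴ = doubledKraus Aᴴ Bᴴ := by
  simp only [doubledKraus_eq_submatrix_kronecker, conjTranspose_submatrix, conjTranspose_kronecker]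

theorem fullSwapSites_apply {n : ℕ} (x y : Fin n → Fin 2 × Fin 2) :
    fullSwapSites (Fin n) x y = if y = fun i => (x i).swap then 1 else 0 := by
  simp only [fullSwapSites, tensorSites, swapOp, of_apply, Fintype.prod_boole]
  congr 1
  rw [eq_iff_iff, funext_iff]
  refine forall_congr' fun i => ?_
  rw [Prod.ext_iff, Prod.fst_swap, Prod.snd_swap]
  grind

/-- The swap trick `Tr[𝕊 (A ⊗ B)] = Tr[A B]`. -/
theorem trace_fullSwapSites_mul_doubledKraus {n : ℕ} (A B : Matrix (QSpace n) (QSpace n) ℂ) :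
    (fullSwapSites (Fin n) * doubledKraus A B).trace = (A * B).trace := by
  simp only [trace, diag_apply, mul_apply, fullSwapSites_apply, ite_mul, one_mul, zero_mul,
    Finset.sum_ite_eq', Finset.mem_univ, if_true]
  rw [Finset.sum_comm, ← Fintype.sum_prod_type']
  exact Fintype.sum_equiv (Equiv.arrowProdEquivProdArrow (Fin n) (fun _ => Fin 2) fun _ => Fin 2)
    _ _ fun x => rfl

/-- The channel with Kraus operators `K`, as a linear map. -/
def krausMap {n s : ℕ} (K : Fin s → Matrix (QSpace n) (QSpace n) ℂ) :
    Matrix (QSpace n) (QSpace n) ℂ →ₗ[ℂ] Matrix (QSpace n) (QSpace n) ℂ where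
  toFun M := ∑ j, K j * M * (K j)ᴴ
  map_add' M N := by simp only [mul_add, add_mul, Finset.sum_add_distrib]
  map_smul' c M := by simp only [mul_smul_comm, smul_mul_assoc, Finset.smul_sum, RingHom.id_apply]

/-- The two-copy channel of `K`, followed by the trace against the full swap, as a linear
functional. -/
def swapTrace {n s : ℕ} (K : Fin s → Matrix (QSpace n) (QSpace n) ℂ) :
    Matrix (Fin n → Fin 2 × Fin 2) (Fin n → Fin 2 × Fin 2) ℂ →ₗ[ℂ] ℂ where
  toFun O := (fullSwapSites (Fin n) * doubledChannel K O).trace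
  map_add' M N := by
    simp only [doubledChannel, mul_add, add_mul, Finset.sum_add_distrib, trace_add]
  map_smul' c M := by
    simp only [doubledChannel, mul_smul_comm, smul_mul_assoc, ← Finset.smul_sum, trace_smul,
      RingHom.id_apply]

theorem swapTrace_doubledKraus {n s : ℕ} (K : Fin s → Matrix (QSpace n) (QSpace n) ℂ)
    (M N : Matrix (QSpace n) (QSpace n) ℂ) :
    swapTrace K (doubledKraus M N) = (krausMap K M * krausMap K N).trace := by
  simp only [swapTrace, krausMap, LinearMap.coe_mk, AddHom.coe_mk, doubledChannel,
    doubledKraus_conjTranspose, doubledKraus_mul, Finset.mul_sum, Finset.sum_mul, trace_sum,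
    trace_fullSwapSites_mul_doubledKraus]
  exact Finset.sum_comm

/-- The matrix entries of `I^{⊗k} ⊗ (|0⟩⟨0|)^{⊗(n−k)}` on the ancilla sites. -/
def ancillaEntry {n : ℕ} (k : ℕ) (x y : QSpace n) : ℂ :=
  ∏ i : Fin n, if (i : ℕ) < k then (1 : ℂ) else (if x i = 0 ∧ y i = 0 then 1 else 0)

/-- The embedding `ζ ↦ ζ ⊗ (|0⟩⟨0|)^{⊗(n−k)}`, as a linear map. -/
def padAncilla {n k : ℕ} (hk : k ≤ n) :
    Matrix (QSpace k) (QSpace k) ℂ →ₗ[ℂ] Matrix (QSpace n) (QSpace n) ℂ where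
  toFun ζ := Matrix.of fun x y => ancillaEntry k x y *
    ζ (fun j => x (Fin.castLE hk j)) (fun j => y (Fin.castLE hk j))
  map_add' ζ ξ := by ext; simp [mul_add]
  map_smul' c ζ := by ext; simp [mul_left_comm]

theorem padAncilla_apply {n k : ℕ} (hk : k ≤ n) (ζ : Matrix (QSpace k) (QSpace k) ℂ)
    (x y : QSpace n) :
    padAncilla hk ζ x y = ancillaEntry k x y *
      ζ (fun j => x (Fin.castLE hk j)) (fun j => y (Fin.castLE hk j)) :=
  rfl

theorem prod_ite_lt_eq_prod_castLE {n k : ℕ} (hk : k ≤ n) (f : Fin n → ℂ) :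
    (∏ i : Fin n, if (i : ℕ) < k then f i else 1) = ∏ j : Fin k, f (Fin.castLE hk j) := by
  obtain ⟨m, rfl⟩ := Nat.exists_eq_add_of_le hk
  rw [Fin.prod_univ_add]
  simp [Fin.castAdd]

theorem ket00_apply (p q : Fin 2 × Fin 2) :
    ket00 p q = (if p.1 = 0 ∧ q.1 = 0 then 1 else 0) * (if p.2 = 0 ∧ q.2 = 0 then 1 else 0) := by
  obtain ⟨a, b⟩ := p
  obtain ⟨c, d⟩ := q
  fin_cases a <;> fin_cases b <;> fin_cases c <;> fin_cases d <;> simp [ket00]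

theorem tensorSites_ket00_apply {n k : ℕ} (hk : k ≤ n)
    (f : Matrix (Fin 2 × Fin 2) (Fin 2 × Fin 2) ℂ) (x y : Fin n → Fin 2 × Fin 2) :
    tensorSites (fun i : Fin n => if (i : ℕ) < k then f else ket00) x y =
      ancillaEntry k (fun i => (x i).1) (fun i => (y i).1) *
        ancillaEntry k (fun i => (x i).2) (fun i => (y i).2) *
        ∏ j : Fin k, f (x (Fin.castLE hk j)) (y (Fin.castLE hk j)) := by
  rw [← prod_ite_lt_eq_prod_castLE hk fun i => f (x i) (y i)]
  simp only [tensorSites, of_apply, ancillaEntry, ← Finset.prod_mul_distrib]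
  refine Finset.prod_congr rfl fun i _ => ?_
  by_cases h : (i : ℕ) < k
  · simp only [h, if_true, one_mul]
  · simp only [h, if_false, ket00_apply, mul_one]

theorem tensorSites_identity_ket00 {n k : ℕ} (hk : k ≤ n) :
    tensorSites (fun i : Fin n => if (i : ℕ) < k then O01 0 else ket00) =
      ((4 : ℂ) ^ k)⁻¹ • doubledKraus (padAncilla hk 1) (padAncilla hk 1) := by
  ext x y
  have h : ∏ j : Fin k, O01 0 (x (Fin.castLE hk j)) (y (Fin.castLE hk j)) =
      ((4 : ℂ) ^ k)⁻¹ *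
        ((1 : Matrix (QSpace k) (QSpace k) ℂ) (fun j => (x (Fin.castLE hk j)).1)
            (fun j => (y (Fin.castLE hk j)).1) *
          (1 : Matrix (QSpace k) (QSpace k) ℂ) (fun j => (x (Fin.castLE hk j)).2)
            (fun j => (y (Fin.castLE hk j)).2)) := by
    simp only [O01, if_true, Matrix.smul_apply, smul_eq_mul, Finset.prod_mul_distrib, Finset.prod_const,
      Finset.card_univ, Fintype.card_fin, inv_pow, one_apply, Fintype.prod_boole, Prod.ext_iff,
      funext_iff, forall_and, ite_zero_mul_ite_zero, mul_one]
  rw [tensorSites_ket00_apply hk, h]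
  simp only [doubledKraus, Matrix.smul_apply, of_apply, padAncilla_apply, smul_eq_mul]
  ring

theorem sum_single_mul_single_swap {A : Type*} [Fintype A] [DecidableEq A] (a b c d : A) :
    ∑ r : A, ∑ r' : A, single r r' (1 : ℂ) a b * single r' r (1 : ℂ) c d =
      if a = d ∧ c = b then 1 else 0 := by
  simp only [single_apply, ite_and, ite_mul, zero_mul, one_mul]
  simp only [Finset.sum_ite_irrel, Finset.sum_const_zero, Finset.sum_ite_eq', Finset.mem_univ,
    if_true]
  grind

theorem tensorSites_swap_ket00 {n k : ℕ} (hk : k ≤ n) :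
    tensorSites (fun i : Fin n => if (i : ℕ) < k then O01 1 else ket00) =
      ((2 : ℂ) ^ k)⁻¹ • ∑ r : QSpace k, ∑ r' : QSpace k,
        doubledKraus (padAncilla hk (single r r' 1)) (padAncilla hk (single r' r 1)) := by
  ext x y
  have h : ∏ j : Fin k, O01 1 (x (Fin.castLE hk j)) (y (Fin.castLE hk j)) =
      ((2 : ℂ) ^ k)⁻¹ * ∑ r : QSpace k, ∑ r' : QSpace k,
        (single r r' (1 : ℂ) (fun j => (x (Fin.castLE hk j)).1)
            (fun j => (y (Fin.castLE hk j)).1) *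
          single r' r (1 : ℂ) (fun j => (x (Fin.castLE hk j)).2)
            (fun j => (y (Fin.castLE hk j)).2)) := by
    rw [sum_single_mul_single_swap]
    simp only [O01, one_ne_zero, if_false, Matrix.smul_apply, smul_eq_mul, Finset.prod_mul_distrib,
      Finset.prod_const, Finset.card_univ, Fintype.card_fin, inv_pow, swapOp, of_apply,
      Fintype.prod_boole, forall_and, funext_iff]
  rw [tensorSites_ket00_apply hk, h]
  simp only [doubledKraus, Matrix.smul_apply, of_apply, padAncilla_apply, smul_eq_mul, Matrix.sum_apply,
    Finset.mul_sum]
  refine Finset.sum_congr rfl fun r _ => Finset.sum_congr rfl fun r' _ => ?_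
  ring

theorem idTensor_maxEnt_apply {A B : Type*} [Fintype A] [DecidableEq A]
    (E : Matrix A A ℂ →ₗ[ℂ] Matrix B B ℂ) (x y : A × B) :
    idTensor (R := A) E (maxEnt A) x y =
      (Fintype.card A : ℂ)⁻¹ * E (single x.1 y.1 1) x.2 y.2 := by
  have h : (Matrix.of fun a a' => maxEnt A (x.1, a) (y.1, a')) =
      (Fintype.card A : ℂ)⁻¹ • single x.1 y.1 (1 : ℂ) := by
    ext a a'
    simp [maxEnt, single_apply]
  rw [idTensor, of_apply, h, map_smul, Matrix.smul_apply, smul_eq_mul]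

theorem ptraceFirst_idTensor_maxEnt {A B : Type*} [Fintype A] [DecidableEq A]
    (E : Matrix A A ℂ →ₗ[ℂ] Matrix B B ℂ) :
    ptraceFirst (idTensor (R := A) E (maxEnt A)) = (Fintype.card A : ℂ)⁻¹ • E 1 := by
  have h : (1 : Matrix A A ℂ) = ∑ r, single r r 1 := by
    ext a a'
    simp [Matrix.sum_apply, single_apply, one_apply, ite_and]
  ext b b'
  simp only [ptraceFirst, of_apply, idTensor_maxEnt_apply]
  rw [h, map_sum, Matrix.smul_apply, Matrix.sum_apply, smul_eq_mul, Finset.mul_sum]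

theorem trace_idTensor_maxEnt_mul_self {A B : Type*} [Fintype A] [DecidableEq A] [Fintype B]
    (E : Matrix A A ℂ →ₗ[ℂ] Matrix B B ℂ) :
    (idTensor (R := A) E (maxEnt A) * idTensor (R := A) E (maxEnt A)).trace =
      (Fintype.card A : ℂ)⁻¹ ^ 2 *
        ∑ r, ∑ r', (E (single r r' 1) * E (single r' r 1)).trace := by
  simp only [trace, diag_apply, mul_apply, idTensor_maxEnt_apply, Fintype.sum_prod_type,
    Finset.mul_sum]
  refine Finset.sum_congr rfl fun r _ => ?_
  rw [Finset.sum_comm]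
  refine Finset.sum_congr rfl fun r' _ => Finset.sum_congr rfl fun b _ =>
    Finset.sum_congr rfl fun b' _ => ?_
  ring

/-- For any `n`-qubit channel `Λ` with Kraus operators `K`, encoding channel
`ℰ(ζ) = Λ(ζ ⊗ |0⟩⟨0|^{⊗(n−k)})` and `ρ = (Id ⊗ ℰ)(|Φ⟩⟨Φ|)`:
`Tr(ρ_B²) = Tr[𝕊 · Λ̃((I/4)^{⊗k} ⊗ (|00⟩⟨00|)^{⊗(n−k)})]` and
`Tr(ρ²) = 2^{−k} Tr[𝕊 · Λ̃((𝒮/2)^{⊗k} ⊗ (|00⟩⟨00|)^{⊗(n−k)})]`. -/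
theorem purity_via_doubled_channel
    (n k s : ℕ) (hk1 : 1 ≤ k) (hkn : k ≤ n)
    (Λ : Matrix (QSpace n) (QSpace n) ℂ → Matrix (QSpace n) (QSpace n) ℂ)
    (K : Fin s → Matrix (QSpace n) (QSpace n) ℂ)
    (hK : (∑ j, (K j)ᴴ * K j) = 1)
    (hΛ : ∀ M, Λ M = ∑ j, K j * M * (K j)ᴴ) :
    (ptraceFirst (idTensor (R := QSpace k) (encode hkn Λ) (maxEnt (QSpace k))) *
        ptraceFirst (idTensor (R := QSpace k) (encode hkn Λ) (maxEnt (QSpace k)))).trace =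
      (fullSwapSites (Fin n) *
        doubledChannel K
          (tensorSites fun i : Fin n => if (i : ℕ) < k then O01 0 else ket00)).trace ∧
    (idTensor (R := QSpace k) (encode hkn Λ) (maxEnt (QSpace k)) *
        idTensor (R := QSpace k) (encode hkn Λ) (maxEnt (QSpace k))).trace =
      ((2 : ℂ) ^ k)⁻¹ *
        (fullSwapSites (Fin n) *
          doubledChannel K
            (tensorSites fun i : Fin n => if (i : ℕ) < k then O01 1 else ket00)).trace := by
  have hE : encode hkn Λ = (krausMap K ∘ₗ padAncilla hkn :
      Matrix (QSpace k) (QSpace k) ℂ →ₗ[ℂ] Matrix (QSpace n) (QSpace n) ℂ) :=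
    funext fun ζ => hΛ _
  have hcard : (Fintype.card (QSpace k) : ℂ) = 2 ^ k := by simp
  have h4 : (4 : ℂ) ^ k = 2 ^ k * 2 ^ k := by rw [← mul_pow]; norm_num
  rw [hE]
  constructor
  · rw [ptraceFirst_idTensor_maxEnt, hcard, tensorSites_identity_ket00 hkn]
    change _ = swapTrace K _
    rw [map_smul, swapTrace_doubledKraus, smul_mul_smul_comm, trace_smul, h4, mul_inv]
    rfl
  · rw [trace_idTensor_maxEnt_mul_self, hcard, tensorSites_swap_ket00 hkn]
    change _ = _ * swapTrace K _
    simp only [map_smul, map_sum, swapTrace_doubledKraus, smul_eq_mul, LinearMap.comp_apply]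
    ring
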